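/- Let s be a weak composition and T ≺ Z in s-weak order. Let (a_1,b_1), …, (a_l,b_l) be the tree ascents of T such that (b_i,a_i) lies in the multi-inversion set difference inv(Z) − inv(T). Then the number of atoms of the closed interval [T,Z] is l, and Z equals the join of the atoms of [T,Z] if and only if inv(Z) = (inv(T) + A_T(a_1,b_1) + ⋯ + A_T(a_l,b_l))^tc. -/

import Mathlib

open scoped Classical

/-- An `s`-decreasing tree with internal vertices `1,…,n` (the root is `n`), encoded by
recording, for each non-root internal vertex `v`, its parent `parent v` (an internal vertex
with a larger label, so that labels decrease away from the root) and the index `idx v` of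
the child slot of `parent v` (among `0,…,s (parent v)`, left to right) containing `v`.
Distinct internal vertices occupy distinct child slots; all remaining slots are leaves. -/
structure SDecTree (n : ℕ) (s : ℕ → ℕ) where
  parent : ℕ → ℕ
  idx : ℕ → ℕ
  parent_gt : ∀ v, 1 ≤ v → v < n → v < parent v
  parent_le : ∀ v, 1 ≤ v → v < n → parent v ≤ n
  idx_le : ∀ v, 1 ≤ v → v < n → idx v ≤ s (parent v)
  slot_inj : ∀ v w, 1 ≤ v → v < n → 1 ≤ w → w < n →
      parent v = parent w → idx v = idx w → v = w
  parent_out : ∀ v, v = 0 ∨ n ≤ v → parent v = 0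
  idx_out : ∀ v, v = 0 ∨ n ≤ v → idx v = 0

namespace SDecTree

variable {n : ℕ} {s : ℕ → ℕ}

/-- `y` is a weak ancestor of `x`, i.e. `x` is a labeled vertex of the subtree `T^y`. -/
def Descend (T : SDecTree n s) (x y : ℕ) : Prop :=
  ∃ k, T.parent^[k] x = y ∧ ∀ m ≤ k, 1 ≤ T.parent^[m] x ∧ T.parent^[m] x ≤ n

/-- `x` is a labeled vertex of the subtree `T^y_j` rooted at the `j`-th child of `y`. -/
def InSub (T : SDecTree n s) (y j x : ℕ) : Prop :=
  ∃ c, T.Descend x c ∧ T.parent c = y ∧ T.idx c = j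

/-- `x` lies strictly left of `y` in the planar tree `T`. -/
def LeftOf (T : SDecTree n s) (x y : ℕ) : Prop :=
  ∃ z j₁ j₂, j₁ < j₂ ∧ T.InSub z j₁ x ∧ T.InSub z j₂ y

/-- The cardinality `#_T(y,x)` of the pair `(y,x)`: it is `j` if `x ∈ T^y_j`
(so `0` if `x ∈ T^y_0` and `s y` if `x ∈ T^y_{s y}`), `0` if `x` is left of `y`, and
`s y` if `x` is right of `y`; it is `0` for out-of-range pairs. -/
noncomputable def card (T : SDecTree n s) (y x : ℕ) : ℕ :=
  if h : ∃ j, T.InSub y j x then h.choose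
  else if 1 ≤ x ∧ x < y ∧ y ≤ n ∧ ¬ T.LeftOf x y then s y else 0

/-- `x` is a labeled vertex of `T^a ∖ 0`, i.e. of `T^a` with `T^a_0` replaced by a leaf. -/
def InSubMinus0 (T : SDecTree n s) (a x : ℕ) : Prop :=
  x = a ∨ ∃ j, 0 < j ∧ T.InSub a j x

/-- `(a,b)` is a tree ascent of `T`. -/
def TreeAscent (T : SDecTree n s) (a b : ℕ) : Prop :=
  1 ≤ a ∧ a < b ∧ b ≤ n ∧
  (∃ i, i < s b ∧ T.InSub b i a) ∧
  (∀ e j, a < e → e < b → T.InSub e j a → j = s e) ∧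
  (0 < s a → ∀ x, ¬ T.InSub a (s a) x)

end SDecTree

/-- A multi-inversion set (encoded by its multiplicity function) is transitive:
if `a < b < c` then `#(b,a) = 0` or `#(c,a) ≥ #(c,b)`. -/
def IsTransitiveInv (I : ℕ → ℕ → ℕ) : Prop :=
  ∀ a b c, a < b → b < c → I b a = 0 ∨ I c b ≤ I c a

/-- The transitive closure of a multi-inversion set: the smallest (by inclusion, i.e.
pointwise on multiplicities) transitive multi-inversion set containing it. -/
noncomputable def tcInv (I : ℕ → ℕ → ℕ) : ℕ → ℕ → ℕ := fun y x =>
  sInf {m | ∃ J : ℕ → ℕ → ℕ, IsTransitiveInv J ∧ (∀ y' x', I y' x' ≤ J y' x') ∧ J y x = m}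

/-- Add one copy of the inversion `(b,a)` to `I`, capping the multiplicity at `s b`. -/
def addInv (s : ℕ → ℕ) (I : ℕ → ℕ → ℕ) (b a : ℕ) : ℕ → ℕ → ℕ := fun y x =>
  if y = b ∧ x = a then min (I y x + 1) (s y) else I y x

namespace SDecTree

variable {n : ℕ} {s : ℕ → ℕ}

/-- The `s`-weak order: `T ⪯ Z` iff `#_T(y,x) ≤ #_Z(y,x)` for all pairs. -/
def wle (T Z : SDecTree n s) : Prop := ∀ y x, T.card y x ≤ Z.card y x

/-- Strict `s`-weak order. -/
def wlt (T Z : SDecTree n s) : Prop := wle T Z ∧ ¬ wle Z T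

/-- Cover relation in the `s`-weak order. -/
def wcov (T Z : SDecTree n s) : Prop := wlt T Z ∧ ∀ U, wlt T U → wlt U Z → False

/-- `W` is the join of `T` and `Z` in the `s`-weak order. -/
def IsJoin (T Z W : SDecTree n s) : Prop :=
  wle T W ∧ wle Z W ∧ ∀ U, wle T U → wle Z U → wle W U

/-- `Z` is the `s`-tree rotation of `T` along the tree ascent `(a,b)`, i.e.
`inv Z = (inv T + (b,a))^tc`. -/
def IsRotation (T Z : SDecTree n s) (a b : ℕ) : Prop :=
  T.TreeAscent a b ∧
  ∀ y x, 1 ≤ x → x < y → y ≤ n → Z.card y x = tcInv (addInv s T.card b a) y x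

/-- The set `A_T(a,b)` of inversions added by a rotation producing `Z`: the pairs `(f,e)`
with `#_Z(f,e) > #_T(f,e)`. -/
def Aset (T Z : SDecTree n s) : Set (ℕ × ℕ) :=
  {p | T.card p.1 p.2 < Z.card p.1 p.2}

/-- The set `A_T(a,b)` described directly via the transitive closure. -/
def ARot (T : SDecTree n s) (a b : ℕ) : Set (ℕ × ℕ) :=
  {p | T.card p.1 p.2 < tcInv (addInv s T.card b a) p.1 p.2}

/-- The set `F_T(a,c)` (here `b` and `d` are the partners of `a` and `c` in the
respective tree ascents `(a,b)` and `(c,d)`): it is `{(d,e) : e ∈ T^a∖0}` if `b = c`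
and `a ∈ T^c_0`, and empty otherwise. -/
def Fset (T : SDecTree n s) (a b c d : ℕ) : Set (ℕ × ℕ) :=
  {p | b = c ∧ T.InSub c 0 a ∧ p.1 = d ∧ T.InSubMinus0 a p.2}

/-- `T` is an `s`-Tamari tree: `#_T(c,a) ≤ #_T(c,b)` whenever `a < b < c`. -/
def IsTamari (T : SDecTree n s) : Prop :=
  ∀ a b c, a < b → b < c → T.card c a ≤ T.card c b

/-- `(a,b)` is a Tamari tree ascent of `T`: `a` is a non-rightmost child of `b`. -/
def TamariAscent (T : SDecTree n s) (a b : ℕ) : Prop :=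
  1 ≤ a ∧ a < n ∧ T.parent a = b ∧ T.card b a < s b

/-- `Z` is the `s`-Tamari rotation of `T` along the Tamari tree ascent `(a,b)`. -/
def IsTamRotation (T Z : SDecTree n s) (a b : ℕ) : Prop :=
  T.TamariAscent a b ∧
  ∀ y x, 1 ≤ x → x < y → y ≤ n → Z.card y x = tcInv (addInv s T.card b a) y x

/-- Cover relation in the `s`-Tamari lattice. -/
def tamcov (T Z : SDecTree n s) : Prop :=
  IsTamari T ∧ IsTamari Z ∧ wlt T Z ∧ ∀ U, IsTamari U → wlt T U → wlt U Z → False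

/-- `W` is the join of `T` and `Z` in the `s`-Tamari lattice. -/
def IsTamJoin (T Z W : SDecTree n s) : Prop :=
  IsTamari W ∧ wle T W ∧ wle Z W ∧ ∀ U, IsTamari U → wle T U → wle Z U → wle W U

/-- The open interval `(T,Z)` in the `s`-weak order. -/
def OpenInterval (T Z : SDecTree n s) : Set (SDecTree n s) := {U | wlt T U ∧ wlt U Z}

/-- A set of trees forming a chain in the `s`-weak order. -/
def IsChainSet (C : Set (SDecTree n s)) : Prop :=
  C.Pairwise fun U V => wlt U V ∨ wlt V U

/-- The geometric realization of the order complex `Δ(T,Z)` of the open interval `(T,Z)`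
in the `s`-weak order: the space of finitely supported probability vectors on the vertex
set whose support is a chain of the open interval. -/
def orderComplex (T Z : SDecTree n s) : Set (SDecTree n s → ℝ) :=
  {f | (∀ U, 0 ≤ f U) ∧ (Function.support f).Finite ∧
    Function.support f ⊆ OpenInterval T Z ∧ IsChainSet (Function.support f) ∧
    ∑ᶠ U, f U = 1}

/-- The geometric realization of the order complex of the open interval `(T,Z)` in the
`s`-Tamari lattice. -/
def tamOrderComplex (T Z : SDecTree n s) : Set (SDecTree n s → ℝ) :=
  {f | (∀ U, 0 ≤ f U) ∧ (Function.support f).Finite ∧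
    Function.support f ⊆ {U | IsTamari U ∧ wlt T U ∧ wlt U Z} ∧
    IsChainSet (Function.support f) ∧ ∑ᶠ U, f U = 1}

end SDecTree

/-- The list of labels of the consecutive cover relations along a saturated chain,
recorded as a list of poset elements. -/
def labelsOf {α : Type*} (lab : α → α → ℕ) (L : List α) : List ℕ :=
  (L.zip L.tail).map fun p => lab p.1 p.2

/-- The multi-inversion set `inv T + A_T(a₁,b₁) + ⋯ + A_T(a_l,b_l)`, summed over all the
tree ascents `(aᵢ,bᵢ)` of `T` with `(bᵢ,aᵢ) ∈ inv Z − inv T`; each `A` set contributes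
multiplicity one at each of its members, and sums are capped at `s y`. -/
noncomputable def ascSum (n : ℕ) (s : ℕ → ℕ) (T Z : SDecTree n s) : ℕ → ℕ → ℕ :=
  fun y x =>
    min (T.card y x +
      {p : ℕ × ℕ | T.TreeAscent p.1 p.2 ∧ T.card p.2 p.1 < Z.card p.2 p.1 ∧
        (y, x) ∈ SDecTree.ARot T p.1 p.2}.ncard)
      (s y)

namespace SDecTree
variable {n : ℕ} {s : ℕ → ℕ}

/-- Abstract inversion sets of `s`-decreasing trees. -/
structure Good (n : ℕ) (s : ℕ → ℕ) (f : ℕ → ℕ → ℕ) : Prop where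
  bd : ∀ y x, f y x ≤ s y
  supp : ∀ y x, f y x ≠ 0 → 1 ≤ x ∧ x < y ∧ y ≤ n
  tr : ∀ a b c, a < b → b < c → f b a = 0 ∨ f c b ≤ f c a
  pl : ∀ a b c, a < b → b < c → f b a = s b ∨ f c a ≤ f c b

/-- `x` is a strict descendant of `y`, in terms of inversion sets. -/
def DD (n : ℕ) (f : ℕ → ℕ → ℕ) (x y : ℕ) : Prop :=
  1 ≤ x ∧ x < y ∧ y ≤ n ∧ ∀ z, y < z → f z x = f z y

theorem Descend.range {T : SDecTree n s} {x y : ℕ} (h : T.Descend x y) :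
    1 ≤ x ∧ x ≤ y ∧ y ≤ n := by
  obtain ⟨k, hk, hm⟩ := h
  have h0 := hm 0 (Nat.zero_le _)
  simp only [Function.iterate_zero, id] at h0
  have key : ∀ m, m ≤ k → x ≤ T.parent^[m] x := by
    intro m
    induction m with
    | zero => intro _; simp
    | succ m ih =>
      intro hmk
      have h1 := ih (by omega)
      have h2 := hm m (by omega)
      have h3 := hm (m+1) hmk
      rw [Function.iterate_succ_apply'] at h3 ⊢
      have h4 : T.parent^[m] x < n := by
        by_contra hc
        have := T.parent_out _ (Or.inr (not_lt.mp hc))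
        omega
      have := T.parent_gt _ h2.1 h4
      omega
  have h1 := key k le_rfl
  have h2 := hm k le_rfl
  rw [hk] at h1 h2
  exact ⟨h0.1, h1, h2.2⟩

theorem Descend.rfl' {T : SDecTree n s} {x : ℕ} (h1 : 1 ≤ x) (h2 : x ≤ n) : T.Descend x x :=
  ⟨0, rfl, fun m hm => by obtain rfl : m = 0 := by omega
                          exact ⟨h1, h2⟩⟩

theorem Descend.trans {T : SDecTree n s} {x y z : ℕ} (h : T.Descend x y) (h' : T.Descend y z) :
    T.Descend x z := by
  obtain ⟨k, hk, hm⟩ := h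
  obtain ⟨l, hl, hm'⟩ := h'
  refine ⟨l + k, by rw [Function.iterate_add_apply, hk, hl], fun m hmk => ?_⟩
  rcases le_or_gt m k with h | h
  · exact hm m h
  · obtain ⟨d, rfl⟩ := Nat.exists_eq_add_of_lt h
    have := hm' (d+1) (by omega)
    rw [← hk, ← Function.iterate_add_apply] at this
    rwa [show k + d + 1 = d + 1 + k by omega]

theorem Descend.parent {T : SDecTree n s} {x : ℕ} (h1 : 1 ≤ x) (h2 : x < n) :
    T.Descend x (T.parent x) := by
  have h3 := T.parent_gt x h1 h2
  have h4 := T.parent_le x h1 h2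
  refine ⟨1, rfl, fun m hm => ?_⟩
  rcases (show m = 0 ∨ m = 1 by omega) with rfl | rfl
  · simp; omega
  · simp; omega

/-- Two weak ancestors of the same vertex are comparable. -/
theorem Descend.total {T : SDecTree n s} {x y z : ℕ} (h : T.Descend x y) (h' : T.Descend x z) :
    T.Descend y z ∨ T.Descend z y := by
  have key : ∀ {y z k l : ℕ}, k ≤ l → T.parent^[k] x = y → T.parent^[l] x = z →
      (∀ m ≤ l, 1 ≤ T.parent^[m] x ∧ T.parent^[m] x ≤ n) → T.Descend y z := by
    intro y z k l hkl hk hl hm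
    refine ⟨l - k, ?_, fun m hmk => ?_⟩
    · rw [← hk, ← Function.iterate_add_apply, Nat.sub_add_cancel hkl, hl]
    · rw [← hk, ← Function.iterate_add_apply]
      exact hm _ (by omega)
  obtain ⟨k, hk, hm⟩ := h
  obtain ⟨l, hl, hm'⟩ := h'
  rcases le_total k l with h | h
  · exact Or.inl (key h hk hl hm')
  · exact Or.inr (key h hl hk hm)

theorem Descend.parent_of_lt {T : SDecTree n s} {x y : ℕ} (h : T.Descend x y) (hxy : x < y) :
    T.Descend (T.parent x) y := by
  have hr := h.range
  rcases h.total (Descend.parent hr.1 (by omega)) with h1 | h1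
  · obtain ⟨k, hk, hm⟩ := h
    rcases k with _ | k
    · simp at hk; omega
    · refine ⟨k, by rwa [← Function.iterate_succ_apply], fun m hmk => ?_⟩
      rw [← Function.iterate_succ_apply]
      exact hm _ (by omega)
  · exact h1

theorem Descend.root {T : SDecTree n s} : ∀ d x : ℕ, n - x = d → 1 ≤ x → x ≤ n → T.Descend x n := by
  intro d
  induction d using Nat.strong_induction_on with
  | _ d ih =>
    intro x hd h1 h2
    rcases h2.eq_or_lt with rfl | h
    · exact Descend.rfl' h1 le_rfl
    · have h3 := T.parent_gt x h1 h
      have h4 := T.parent_le x h1 h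
      exact (Descend.parent h1 h).trans (ih (n - T.parent x) (by omega) _ rfl (by omega) h4)

theorem InSub.range {T : SDecTree n s} {y j x : ℕ} (h : T.InSub y j x) (hy : 1 ≤ y) :
    1 ≤ x ∧ x < y ∧ y ≤ n ∧ j ≤ s y := by
  obtain ⟨c, hc, hp, hi⟩ := h
  have := hc.range
  have hcn : c < n := by
    by_contra h
    have := T.parent_out c (Or.inr (not_lt.mp h))
    omega
  have h1 := T.parent_gt c (by omega) hcn
  have h2 := T.parent_le c (by omega) hcn
  have h3 := T.idx_le c (by omega) hcn
  subst hp hi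
  omega

theorem InSub.desc {T : SDecTree n s} {y j x : ℕ} (h : T.InSub y j x) (hy : 1 ≤ y) :
    T.Descend x y := by
  have hr := h.range hy
  obtain ⟨c, hc, hp, hi⟩ := h
  have := hc.range
  have hcn : c < n := by
    by_contra h
    have := T.parent_out c (Or.inr (not_lt.mp h))
    omega
  rw [← hp]
  exact hc.trans (Descend.parent (by omega) hcn)

theorem exists_child {T : SDecTree n s} {x y : ℕ} (h : T.Descend x y) (hxy : x < y) :
    ∃ c, T.Descend x c ∧ T.parent c = y ∧ 1 ≤ c ∧ c < n ∧ c < y := by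
  obtain ⟨k, hk, hm⟩ := h
  rcases k with _ | k
  · simp at hk; omega
  have hd : T.Descend x (T.parent^[k] x) := ⟨k, rfl, fun m hmk => hm m (by omega)⟩
  have hr := hd.range
  rw [Function.iterate_succ_apply'] at hk
  have hcn : T.parent^[k] x < n := by
    by_contra h
    have := T.parent_out _ (Or.inr (not_lt.mp h))
    omega
  have := T.parent_gt _ (by omega) hcn
  exact ⟨_, hd, hk, by omega, hcn, by omega⟩

theorem InSub.of_desc {T : SDecTree n s} {x y : ℕ} (h : T.Descend x y) (hxy : x < y) :
    ∃ j, T.InSub y j x := by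
  obtain ⟨c, h1, h2, _⟩ := exists_child h hxy
  exact ⟨_, c, h1, h2, rfl⟩

theorem InSub.up {T : SDecTree n s} {x y z j : ℕ} (h : T.Descend x y) (h' : T.InSub z j y) :
    T.InSub z j x := by
  obtain ⟨c, hc, hp, hi⟩ := h'
  exact ⟨c, h.trans hc, hp, hi⟩

theorem InSub.unique {T : SDecTree n s} {x y j j' : ℕ} (h : T.InSub y j x) (h' : T.InSub y j' x) :
    j = j' := by
  obtain ⟨c, hc, hp, hi⟩ := h
  obtain ⟨c', hc', hp', hi'⟩ := h'
  have key : ∀ c c', T.Descend c c' → T.parent c = y → T.parent c' = y → c = c' := by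
    intro c c' h h1 h2
    by_contra hne
    have hr := h.range
    have h3 := (h.parent_of_lt (by omega)).range
    rcases Nat.lt_or_ge c' n with h4 | h4
    · have := T.parent_gt c' (by omega) h4
      omega
    · have := T.parent_out c' (Or.inr h4)
      omega
  have : c = c' := by
    rcases hc.total hc' with h | h
    · exact key _ _ h hp hp'
    · exact (key _ _ h hp' hp).symm
  rw [← hi, ← hi', this]

theorem InSub.mid {T : SDecTree n s} {x z w j k : ℕ} (hz : 1 ≤ z) (h : T.InSub z j x)
    (h' : T.InSub w k x) (hzw : z < w) : T.InSub w k z := by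
  have h1 := h.desc hz
  have h2 := h'.desc (by omega)
  have h3 : T.Descend z w := by
    rcases h1.total h2 with h | h
    · exact h
    · have := h.range; omega
  obtain ⟨k', hk'⟩ := InSub.of_desc h3 hzw
  rw [h'.unique (InSub.up h1 hk')]
  exact hk'

/-- Two vertices in different child subtrees of `z`. -/
theorem branch_exists {T : SDecTree n s} {x y : ℕ} (h1 : 1 ≤ x) (hxy : x < y) (hy : y ≤ n)
    (h : ¬ ∃ j, T.InSub y j x) :
    ∃ z j₁ j₂, y < z ∧ j₁ ≠ j₂ ∧ T.InSub z j₁ x ∧ T.InSub z j₂ y := by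
  have hex : ∃ z, T.Descend x z ∧ T.Descend y z :=
    ⟨n, Descend.root _ x rfl h1 (by omega), Descend.root _ y rfl (by omega) hy⟩
  obtain ⟨hx, hy'⟩ := Nat.find_spec hex
  have hmin := fun m => Nat.find_min (H := hex) (m := m)
  set z := Nat.find hex
  have hr := hy'.range
  have hyz : y < z := by
    rcases hr.2.1.eq_or_lt with h' | h'
    · rw [← h'] at hx
      exact absurd (InSub.of_desc hx hxy) h
    · exact h'
  obtain ⟨c, hc, hp, hc1, hcn, hcz⟩ := exists_child hx (by omega)
  obtain ⟨c', hc', hp', hc1', hcn', hcz'⟩ := exists_child hy' hyz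
  refine ⟨z, T.idx c, T.idx c', hyz, fun hi => ?_, ⟨c, hc, hp, rfl⟩, ⟨c', hc', hp', rfl⟩⟩
  have := T.slot_inj c c' hc1 hcn hc1' hcn' (by rw [hp, hp']) hi
  subst this
  exact hmin c hcz ⟨hc, hc'⟩

theorem card_of_inSub {T : SDecTree n s} {y j x : ℕ} (h : T.InSub y j x) : T.card y x = j := by
  have h' : ∃ j, T.InSub y j x := ⟨j, h⟩
  rw [card, dif_pos h']
  exact h'.choose_spec.unique h

theorem zero_inSub {T : SDecTree n s} {j x : ℕ} (h : T.InSub 0 j x) : j = 0 := by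
  obtain ⟨c, hc, hp, hi⟩ := h
  have hr := hc.range
  rw [← hi]
  apply T.idx_out
  by_contra hh
  have := T.parent_gt c (by omega) (by omega)
  omega

/-- `x` and `y` branch at `z` with indices `i` and `j`. -/
def Br (T : SDecTree n s) (x y z i j : ℕ) : Prop :=
  1 ≤ z ∧ T.InSub z i x ∧ T.InSub z j y

theorem Br.not_inSub {T : SDecTree n s} {x y z i j k : ℕ} (h : T.Br x y z i j) (hij : i ≠ j)
    (hy : 1 ≤ y) : ¬ T.InSub y k x := fun h' =>
  hij (h.2.1.unique (InSub.up (h'.desc hy) h.2.2))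

theorem Br.unique {T : SDecTree n s} {x y z i j w k l : ℕ} (h : T.Br x y z i j) (hij : i ≠ j)
    (h' : T.Br x y w k l) (hkl : k ≠ l) : z = w := by
  rcases lt_trichotomy z w with hlt | h1 | hlt
  · exact absurd ((InSub.mid h.1 h.2.1 h'.2.1 hlt).unique (InSub.mid h.1 h.2.2 h'.2.2 hlt)) hkl
  · exact h1
  · exact absurd ((InSub.mid h'.1 h'.2.1 h.2.1 hlt).unique (InSub.mid h'.1 h'.2.2 h.2.2 hlt)) hij

theorem Br.card_left {T : SDecTree n s} {x y z i j : ℕ} (h : T.Br x y z i j) (hij : i < j)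
    (hy : 1 ≤ y) : T.card y x = 0 := by
  have h1 : ¬ ∃ j, T.InSub y j x := fun ⟨k, hk⟩ => h.not_inSub hij.ne hy hk
  rw [card, dif_neg h1, if_neg]
  rintro ⟨-, -, -, h2⟩
  exact h2 ⟨z, i, j, hij, h.2.1, h.2.2⟩

theorem Br.card_right {T : SDecTree n s} {x y z i j : ℕ} (h : T.Br x y z i j) (hij : j < i)
    (hxy : x < y) : T.card y x = s y := by
  have hr := h.2.1.range h.1
  have hr' := h.2.2.range h.1
  have h1 : ¬ ∃ j, T.InSub y j x := fun ⟨k, hk⟩ => h.not_inSub hij.ne' hr'.1 hk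
  rw [card, dif_neg h1, if_pos]
  refine ⟨hr.1, hxy, by omega, ?_⟩
  rintro ⟨w, k, l, hkl, h2, h3⟩
  have hw : 1 ≤ w := by
    by_contra hw
    obtain rfl : w = 0 := by omega
    have := zero_inSub h2
    have := zero_inSub h3
    omega
  obtain rfl := h.unique hij.ne' ⟨hw, h2, h3⟩ hkl.ne
  have := h2.unique h.2.1
  have := h3.unique h.2.2
  omega

theorem card_out {T : SDecTree n s} {x y : ℕ} (h : ¬ (1 ≤ x ∧ x < y ∧ y ≤ n)) :
    T.card y x = 0 := by
  by_cases hj : ∃ j, T.InSub y j x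
  · obtain ⟨j, hj⟩ := hj
    rw [card_of_inSub hj]
    rcases Nat.eq_zero_or_pos y with rfl | hy
    · exact zero_inSub hj
    · have := hj.range hy
      exact absurd ⟨this.1, this.2.1, this.2.2.1⟩ h
  · rw [card, dif_neg hj, if_neg]
    rintro ⟨h1, h2, h3, -⟩
    exact h ⟨h1, h2, h3⟩

/-- Trichotomy for a pair `x < y`. -/
theorem cases_pair (T : SDecTree n s) {x y : ℕ} (h1 : 1 ≤ x) (hxy : x < y) (hy : y ≤ n) :
    (∃ j, T.InSub y j x ∧ T.card y x = j) ∨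
    (∃ z i j, y < z ∧ i < j ∧ T.Br x y z i j ∧ T.card y x = 0) ∨
    (∃ z i j, y < z ∧ j < i ∧ T.Br x y z i j ∧ T.card y x = s y) := by
  by_cases hj : ∃ j, T.InSub y j x
  · obtain ⟨j, hj⟩ := hj
    exact Or.inl ⟨j, hj, card_of_inSub hj⟩
  · obtain ⟨z, i, j, hz, hij, hx, hy'⟩ := branch_exists h1 hxy hy hj
    have hb : T.Br x y z i j := ⟨by omega, hx, hy'⟩
    rcases lt_or_gt_of_ne hij with h | h
    · exact Or.inr (Or.inl ⟨z, i, j, hz, h, hb, hb.card_left h (by omega)⟩)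
    · exact Or.inr (Or.inr ⟨z, i, j, hz, h, hb, hb.card_right h hxy⟩)

theorem card_le (T : SDecTree n s) (y x : ℕ) : T.card y x ≤ s y := by
  by_cases h : 1 ≤ x ∧ x < y ∧ y ≤ n
  · rcases T.cases_pair h.1 h.2.1 h.2.2 with ⟨j, hj, hc⟩ | ⟨z, i, j, _, _, _, hc⟩ |
      ⟨z, i, j, _, _, _, hc⟩
    · rw [hc]; exact (hj.range (by omega)).2.2.2
    · omega
    · omega
  · rw [card_out h]; omega

theorem card_eq_of_desc {T : SDecTree n s} {x y z : ℕ} (h : T.Descend x y) (hz : y < z) :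
    T.card z x = T.card z y := by
  have hr := h.range
  by_cases hzn : z ≤ n
  · rcases T.cases_pair (x := y) (y := z) (by omega) hz hzn with ⟨j, hj, hc⟩ |
      ⟨w, i, j, hw, hij, hb, hc⟩ | ⟨w, i, j, hw, hij, hb, hc⟩
    · rw [hc]; exact card_of_inSub (InSub.up h hj)
    · rw [hc]
      exact Br.card_left (z := w) ⟨hb.1, InSub.up h hb.2.1, hb.2.2⟩ hij (by omega)
    · rw [hc]
      exact Br.card_right (z := w) ⟨hb.1, InSub.up h hb.2.1, hb.2.2⟩ hij (by omega)
  · rw [card_out (by omega), card_out (by omega)]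

theorem inSub_iff (T : SDecTree n s) {y j x : ℕ} (hy : 1 ≤ y) :
    T.InSub y j x ↔ DD n T.card x y ∧ T.card y x = j := by
  constructor
  · intro h
    have hr := h.range hy
    exact ⟨⟨hr.1, hr.2.1, hr.2.2.1, fun z hz => card_eq_of_desc (h.desc hy) hz⟩, card_of_inSub h⟩
  · rintro ⟨⟨h1, h2, h3, h4⟩, h5⟩
    by_cases hj : ∃ j, T.InSub y j x
    · obtain ⟨j', hj⟩ := hj
      rw [card_of_inSub hj] at h5
      rwa [← h5]
    · obtain ⟨z, i, k, hz, hik, hx, hy'⟩ := branch_exists h1 h2 h3 hj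
      have := h4 z hz
      rw [card_of_inSub hx, card_of_inSub hy'] at this
      exact absurd this hik

/-- If `a` and `b` branch at `z` and `c < z`, and `b` is inside or right of `c`
then `a` is right of `c` whenever `a` is right of `b`. -/
theorem right_trans {T : SDecTree n s} {a b c z i j : ℕ} (hac : a < c) (hbc : b < c) (hb1 : 1 ≤ b)
    (hcn : c ≤ n) (hcz : c < z)
    (hb : T.Br a b z i j) (hij : j < i) : T.card c b = 0 ∨ T.card c a = s c := by
  rcases T.cases_pair hb1 hbc hcn with ⟨k, hk, hc⟩ | ⟨w, k, l, hw, hkl, hbr, hc⟩ |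
    ⟨w, k, l, hw, hkl, hbr, hc⟩
  · right
    exact Br.card_right (z := z) (i := i) (j := j)
      ⟨hb.1, hb.2.1, InSub.mid (by omega) hk hb.2.2 hcz⟩ hij hac
  · exact Or.inl hc
  · right
    rcases lt_trichotomy w z with h | rfl | h
    · have h1 := InSub.mid hbr.1 hbr.2.1 hb.2.2 h
      exact Br.card_right (z := z) (i := i) (j := j)
        ⟨hb.1, hb.2.1, InSub.up (hbr.2.2.desc hbr.1) h1⟩ hij hac
    · have := hbr.2.1.unique hb.2.2
      exact Br.card_right (z := w) (i := i) (j := l) ⟨hb.1, hb.2.1, hbr.2.2⟩ (by omega) hac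
    · have h1 := InSub.mid hb.1 hb.2.2 hbr.2.1 h
      exact Br.card_right (z := w) (i := k) (j := l)
        ⟨hbr.1, InSub.up (hb.2.1.desc hb.1) h1, hbr.2.2⟩ hkl hac

theorem card_good (T : SDecTree n s) : Good n s T.card where
  bd := T.card_le
  supp y x h := by
    by_contra h'
    exact h (card_out h')
  tr a b c hab hbc := by
    by_cases hr : 1 ≤ a ∧ c ≤ n
    swap
    · by_cases hc : c ≤ n
      · left
        rw [card_out (by omega)]
      · right
        rw [card_out (by omega)]; omega
    rcases T.cases_pair hr.1 hab (by omega) with ⟨k, hk, hc⟩ | ⟨w, k, l, hw, hkl, hbr, hc⟩ |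
      ⟨w, k, l, hw, hkl, hbr, hc⟩
    · right
      rw [card_eq_of_desc (hk.desc (by omega)) hbc]
    · exact Or.inl hc
    · right
      rcases lt_trichotomy c w with h | rfl | h
      · have := T.card_le c b
        rcases right_trans (by omega) hbc (by omega) hr.2 h hbr hkl with h | h <;> omega
      · rw [card_of_inSub hbr.2.1, card_of_inSub hbr.2.2]; omega
      · rw [card_eq_of_desc (hbr.2.1.desc hbr.1) h, card_eq_of_desc (hbr.2.2.desc hbr.1) h]
  pl a b c hab hbc := by
    by_cases hr : 1 ≤ a ∧ c ≤ n
    swap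
    · right
      rw [card_out (by omega)]; omega
    rcases T.cases_pair hr.1 hab (by omega) with ⟨k, hk, hc⟩ | ⟨w, k, l, hw, hkl, hbr, hc⟩ |
      ⟨w, k, l, hw, hkl, hbr, hc⟩
    · right
      rw [card_eq_of_desc (hk.desc (by omega)) hbc]
    · right
      have hbr' : T.Br b a w l k := ⟨hbr.1, hbr.2.2, hbr.2.1⟩
      rcases lt_trichotomy c w with h | rfl | h
      · have := T.card_le c a
        rcases right_trans hbc (by omega) hr.1 hr.2 h hbr' hkl with h | h <;> omega
      · rw [card_of_inSub hbr.2.1, card_of_inSub hbr.2.2]; omega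
      · rw [card_eq_of_desc (hbr.2.1.desc hbr.1) h, card_eq_of_desc (hbr.2.2.desc hbr.1) h]
    · exact Or.inl hc

end SDecTree
namespace SDecTree
variable {n : ℕ} {s : ℕ → ℕ}

theorem parent_le_of_card_eq {T T' : SDecTree n s} (h : T.card = T'.card) {v : ℕ} (h1 : 1 ≤ v)
    (h2 : v < n) : T'.parent v ≤ T.parent v := by
  have hg := T.parent_gt v h1 h2
  have hi : T.InSub (T.parent v) (T.idx v) v := ⟨v, Descend.rfl' h1 h2.le, rfl, rfl⟩
  rw [inSub_iff T (by omega), h, ← inSub_iff T' (by omega)] at hi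
  exact ((hi.desc (by omega)).parent_of_lt hg).range.2.1

theorem card_injective {T T' : SDecTree n s} (h : T.card = T'.card) : T = T' := by
  have hp : T.parent = T'.parent := by
    funext v
    by_cases hv : 1 ≤ v ∧ v < n
    · exact le_antisymm (parent_le_of_card_eq h.symm hv.1 hv.2)
        (parent_le_of_card_eq h hv.1 hv.2)
    · rw [T.parent_out v (by omega), T'.parent_out v (by omega)]
  have hi : T.idx = T'.idx := by
    funext v
    by_cases hv : 1 ≤ v ∧ v < n
    · have h1 : T.InSub (T.parent v) (T.idx v) v := ⟨v, Descend.rfl' hv.1 hv.2.le, rfl, rfl⟩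
      have h2 : T'.InSub (T'.parent v) (T'.idx v) v := ⟨v, Descend.rfl' hv.1 hv.2.le, rfl, rfl⟩
      rw [← card_of_inSub h1, ← card_of_inSub h2, hp, h]
    · rw [T.idx_out v (by omega), T'.idx_out v (by omega)]
  cases T; cases T'
  simp only at hp hi
  subst hp hi
  rfl

section abstract_sets
variable {f : ℕ → ℕ → ℕ}

theorem Good.out (hf : Good n s f) {y x : ℕ} (h : ¬ (1 ≤ x ∧ x < y ∧ y ≤ n)) : f y x = 0 := by
  by_contra h'
  exact h (hf.supp _ _ h')

/-- squeeze -/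
theorem Good.squeeze (hf : Good n s f) {v w z : ℕ} (hv : v < z) (hw : w < z)
    (h : f z v < f z w) {u : ℕ} (hu : z < u) : f u v ≤ f u z ∧ f u z ≤ f u w := by
  have h1 := hf.pl v z u hv hu
  have h2 := hf.tr w z u hw hu
  have h3 := hf.bd z w
  omega

theorem Good.consistent (hf : Good n s f) {x y u u' : ℕ} (hx : x < u) (hy : y < u)
    (hx' : x < u') (hy' : y < u') (h : f u x < f u y) : f u' x ≤ f u' y := by
  rcases lt_trichotomy u u' with h1 | rfl | h1
  · have := hf.squeeze hx hy h h1
    omega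
  · omega
  · by_contra hc
    have := hf.squeeze hy' hx' (not_le.mp hc) h1
    omega

theorem DD.trans {x y z : ℕ} (h : DD n f x y) (h' : DD n f y z) : DD n f x z :=
  ⟨h.1, h.2.1.trans h'.2.1, h'.2.2.1, fun u hu => by
    rw [h.2.2.2 u (h'.2.1.trans hu), h'.2.2.2 u hu]⟩

theorem DD.mid {x y z : ℕ} (h : DD n f x y) (h' : DD n f x z) (hyz : y < z) : DD n f y z :=
  ⟨by have := h.1; have := h.2.1; omega, hyz, h'.2.2.1, fun u hu => by
    rw [← h.2.2.2 u (hyz.trans hu), h'.2.2.2 u hu]⟩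

/-- Vertices that are distinguished have a branching vertex. -/
theorem Good.branch (hf : Good n s f) {x y m : ℕ} (hx1 : 1 ≤ x) (hy1 : 1 ≤ y) (hx : x < m)
    (hy : y < m) (h : f m x ≠ f m y) :
    ∃ z, m ≤ z ∧ f z x ≠ f z y ∧ DD n f x z ∧ DD n f y z ∧ ∀ u, z < u → f u x = f u y := by
  have hb : ∀ z, x < z → y < z → f z x ≠ f z y → z ≤ n := by
    intro z hxz hyz hz
    by_contra hc
    rw [hf.out (by omega), hf.out (by omega)] at hz
    exact hz rfl
  let P : ℕ → Prop := fun z => m ≤ z ∧ f z x ≠ f z y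
  have hP : P m := ⟨le_rfl, h⟩
  have hmn := hb m hx hy h
  have hspec : P (Nat.findGreatest P n) := Nat.findGreatest_spec hmn hP
  have hmax : ∀ u, Nat.findGreatest P n < u → f u x = f u y := by
    intro u hu
    by_contra hne
    have hmu : m ≤ u := hspec.1.trans hu.le
    have := Nat.le_findGreatest (P := P) (hb u (by omega) (by omega) hne) ⟨hmu, hne⟩
    omega
  set z := Nat.findGreatest P n
  obtain ⟨hmz, hz⟩ := hspec
  have hzn := hb z (by omega) (by omega) hz
  have key : ∀ u, z < u → f u x = f u z ∧ f u y = f u z := by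
    intro u hu
    have h1 := hmax u hu
    rcases lt_or_gt_of_ne hz with h | h
    · have := hf.squeeze (by omega) (by omega) h hu
      omega
    · have := hf.squeeze (by omega) (by omega) h hu
      omega
  exact ⟨z, hmz, hz, ⟨hx1, by omega, hzn, fun u hu => (key u hu).1⟩,
    ⟨hy1, by omega, hzn, fun u hu => (key u hu).2⟩, hmax⟩

theorem Good.not_DD (hf : Good n s f) {x y : ℕ} (h1 : 1 ≤ x) (hxy : x < y) (hy : y ≤ n)
    (h : ¬ DD n f x y) : ∃ z, y < z ∧ f z x ≠ f z y ∧ DD n f x z ∧ DD n f y z := by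
  have : ∃ m, y < m ∧ f m x ≠ f m y := by
    by_contra hc
    push Not at hc
    exact h ⟨h1, hxy, hy, hc⟩
  obtain ⟨m, hm, hne⟩ := this
  obtain ⟨z, hz, h2, h3, h4, -⟩ := hf.branch h1 (by omega) (by omega) hm hne
  exact ⟨z, by omega, h2, h3, h4⟩

theorem Good.exists_DD (hf : Good n s f) {v : ℕ} (h1 : 1 ≤ v) (h2 : v < n) :
    ∃ y, DD n f v y :=
  ⟨n, h1, h2, le_rfl, fun z hz => by rw [hf.out (by omega), hf.out (by omega)]⟩

/-- Parent of the tree built from `f`. -/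
noncomputable def par (n : ℕ) (f : ℕ → ℕ → ℕ) (v : ℕ) : ℕ :=
  if h : ∃ y, DD n f v y then Nat.find h else 0

theorem par_spec {v y : ℕ} (h : DD n f v y) : DD n f v (par n f v) ∧ par n f v ≤ y := by
  have h' : ∃ y, DD n f v y := ⟨y, h⟩
  rw [par, dif_pos h']
  exact ⟨Nat.find_spec h', Nat.find_min' h' h⟩

theorem par_out {v : ℕ} (h : v = 0 ∨ n ≤ v) : par n f v = 0 := by
  rw [par, dif_neg]
  rintro ⟨y, h1, h2, h3, -⟩
  omega

theorem Good.slot (hf : Good n s f) {v w : ℕ} (hv : 1 ≤ v) (hvw : v < w) (hw : w < n)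
    (hp : par n f v = par n f w) (hi : f (par n f v) v = f (par n f w) w) : False := by
  obtain ⟨_, hv'⟩ := hf.exists_DD hv (by omega)
  obtain ⟨_, hw'⟩ := hf.exists_DD (v := w) (by omega) hw
  have h1 := (par_spec hv').1
  have h2 := (par_spec hw').1
  rw [hp] at h1 hi
  set y := par n f w with hy
  have hlt := h2.2.1
  have hnd : ¬ DD n f v w := fun h => by
    have := (par_spec h).2
    omega
  obtain ⟨z, hz, hne, hd, -⟩ := hf.not_DD hv hvw hw.le hnd
  have h3 := (par_spec hd).2
  rw [hp] at h3
  rcases h3.eq_or_lt with rfl | h3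
  · exact hne hi
  · exact hne (by rw [h1.2.2.2 z h3, h2.2.2.2 z h3])

/-- The tree with inversion set `f`. -/
noncomputable def ofGood (hf : Good n s f) : SDecTree n s where
  parent := par n f
  idx v := f (par n f v) v
  parent_gt v h1 h2 := by
    obtain ⟨_, h⟩ := hf.exists_DD h1 h2
    exact (par_spec h).1.2.1
  parent_le v h1 h2 := by
    obtain ⟨_, h⟩ := hf.exists_DD h1 h2
    exact (par_spec h).1.2.2.1
  idx_le v h1 h2 := hf.bd _ _
  slot_inj v w hv hvn hw hwn hp hi := by
    rcases lt_trichotomy v w with h | h | h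
    · exact (hf.slot hv h hwn hp hi).elim
    · exact h
    · exact (hf.slot hw h hvn hp.symm hi.symm).elim
  parent_out v h := par_out h
  idx_out v h := by
    rw [par_out h]
    exact hf.out (by omega)

theorem DD.descend (hf : Good n s f) : ∀ d x y, y - x = d → DD n f x y →
    (ofGood hf).Descend x y := by
  intro d
  induction d using Nat.strong_induction_on with
  | _ d ih =>
    intro x y hd h
    obtain ⟨h1, h2⟩ := par_spec h
    have h3 := h.2.1
    have h4 := h.2.2.1
    have h5 : (ofGood hf).Descend x (par n f x) :=
      Descend.parent (T := ofGood hf) h.1 (by omega)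
    rcases h2.eq_or_lt with he | hlt
    · rwa [he] at h5
    · have h6 := h1.2.1
      exact h5.trans (ih _ (by omega) _ _ rfl (h1.mid h hlt))

theorem Descend.dd (hf : Good n s f) : ∀ d x y, y - x = d → x < y → (ofGood hf).Descend x y →
    DD n f x y := by
  intro d
  induction d using Nat.strong_induction_on with
  | _ d ih =>
    intro x y hd hxy h
    have hr := h.range
    obtain ⟨_, hd'⟩ := hf.exists_DD hr.1 (by omega)
    have h1 := (par_spec hd').1
    have h2 : (ofGood hf).Descend (par n f x) y := h.parent_of_lt hxy
    have h3 := h1.2.1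
    rcases h2.range.2.1.eq_or_lt with he | hlt
    · rwa [he] at h1
    · exact h1.trans (ih _ (by omega) _ _ rfl hlt h2)

theorem ofGood_inSub (hf : Good n s f) {y j x : ℕ} (hy : 1 ≤ y) :
    (ofGood hf).InSub y j x ↔ DD n f x y ∧ f y x = j := by
  have key : ∀ c, (ofGood hf).Descend x c → c < y → f y c = f y x := by
    intro c hc hcy
    rcases hc.range.2.1.eq_or_lt with rfl | hlt
    · rfl
    · exact ((Descend.dd hf _ _ _ rfl hlt hc).2.2.2 y hcy).symm
  constructor
  · intro h
    have hr := h.range hy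
    refine ⟨Descend.dd hf _ _ _ rfl hr.2.1 (h.desc hy), ?_⟩
    obtain ⟨c, hc, hp, hi⟩ := h
    have hcr := hc.range
    have hcn : c < n := by
      by_contra hcn
      have := (ofGood hf).parent_out c (Or.inr (not_lt.mp hcn))
      omega
    have hcy := (ofGood hf).parent_gt c (by omega) hcn
    rw [hp] at hcy
    rw [← hi, ← key c hc hcy, ← hp]
    rfl
  · rintro ⟨h, rfl⟩
    obtain ⟨c, hc, hp, h1, h2, h3⟩ := exists_child (DD.descend hf _ _ _ rfl h) h.2.1
    refine ⟨c, hc, hp, ?_⟩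
    rw [← key c hc h3, ← hp]
    rfl

theorem ofGood_card (hf : Good n s f) : (ofGood hf).card = f := by
  funext y x
  by_cases hr : 1 ≤ x ∧ x < y ∧ y ≤ n
  swap
  · rw [card_out hr, hf.out hr]
  obtain ⟨hx, hxy, hy⟩ := hr
  by_cases hd : DD n f x y
  · exact card_of_inSub ((ofGood_inSub hf (by omega)).2 ⟨hd, rfl⟩)
  · obtain ⟨z, hz, hne, h1, h2⟩ := hf.not_DD hx hxy hy hd
    have hb : (ofGood hf).Br x y z (f z x) (f z y) :=
      ⟨by omega, (ofGood_inSub hf (by omega)).2 ⟨h1, rfl⟩, (ofGood_inSub hf (by omega)).2 ⟨h2, rfl⟩⟩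
    rcases lt_or_gt_of_ne hne with h | h
    · rw [hb.card_left h (by omega)]
      have := hf.tr x y z hxy hz
      omega
    · rw [hb.card_right h hxy]
      have := hf.pl x y z hxy hz
      omega

end abstract_sets
end SDecTree
namespace SDecTree
variable {n : ℕ} {s : ℕ → ℕ} {f : ℕ → ℕ → ℕ}

/-- Tree ascents in terms of inversion sets. -/
structure Asc (n : ℕ) (s : ℕ → ℕ) (f : ℕ → ℕ → ℕ) (a b : ℕ) : Prop where
  dd : DD n f a b
  lt : f b a < s b
  mid : ∀ e, e < b → DD n f a e → f e a = s e
  leaf : 0 < s a → ∀ x, DD n f x a → f a x ≠ s a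

theorem treeAscent_iff (T : SDecTree n s) {a b : ℕ} : T.TreeAscent a b ↔ Asc n s T.card a b := by
  constructor
  · rintro ⟨h1, h2, h3, ⟨i, hi, hin⟩, h4, h5⟩
    rw [inSub_iff T (by omega)] at hin
    refine ⟨hin.1, by rw [hin.2]; exact hi, fun e he hd => ?_, fun hs x hd hx => ?_⟩
    · have hae := hd.2.1
      exact h4 e _ hae he ((inSub_iff T (by omega)).2 ⟨hd, rfl⟩)
    · exact h5 hs x ((inSub_iff T h1).2 ⟨hd, hx⟩)
  · intro h
    have h1 := h.dd.1
    have h2 := h.dd.2.1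
    refine ⟨h1, h2, h.dd.2.2.1, ⟨_, h.lt, (inSub_iff T (by omega)).2 ⟨h.dd, rfl⟩⟩, ?_, ?_⟩
    · intro e j hae heb hin
      rw [inSub_iff T (by omega)] at hin
      rw [← hin.2]
      exact h.mid e heb hin.1
    · intro hs x hin
      rw [inSub_iff T h1] at hin
      exact h.leaf hs x hin.1 hin.2

/-- `x` is a vertex of `T^a ∖ 0`. -/
def MM (n : ℕ) (f : ℕ → ℕ → ℕ) (a x : ℕ) : Prop := x = a ∨ (DD n f x a ∧ 0 < f a x)

/-- Explicit rotated inversion set. -/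
noncomputable def rotf (n : ℕ) (f : ℕ → ℕ → ℕ) (a b : ℕ) : ℕ → ℕ → ℕ := fun y x =>
  if y = b ∧ MM n f a x then f y x + 1 else f y x

theorem rotf_pos {a b x : ℕ} (h : MM n f a x) : rotf n f a b b x = f b x + 1 := if_pos ⟨rfl, h⟩

theorem rotf_ne {a b y x : ℕ} (h : y ≠ b) : rotf n f a b y x = f y x :=
  if_neg fun h' => h h'.1

theorem rotf_neg {a b y x : ℕ} (h : ¬ MM n f a x) : rotf n f a b y x = f y x :=
  if_neg fun h' => h h'.2

theorem le_rotf (a b y x : ℕ) : f y x ≤ rotf n f a b y x := by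
  rw [rotf]; split_ifs <;> omega

theorem MM.dd {a b x : ℕ} (h : MM n f a x) (hab : DD n f a b) : DD n f x b := by
  rcases h with rfl | h
  · exact hab
  · exact h.1.trans hab

theorem MM.eq {a x : ℕ} (h : MM n f a x) {z : ℕ} (hz : a < z) : f z x = f z a := by
  rcases h with rfl | h
  · rfl
  · exact h.1.2.2.2 z hz

theorem MM.le {a x : ℕ} (h : MM n f a x) : x ≤ a := by
  rcases h with rfl | h
  · exact le_rfl
  · exact h.1.2.1.le

theorem Asc.inside (hf : Good n s f) {a b : ℕ} (h : Asc n s f a b) {x : ℕ} (hx : x < a)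
    (hpos : 0 < f a x) (hb : f b x ≤ f b a) : DD n f x a := by
  have h1 := h.dd.1
  have h2 := h.dd.2.1
  have h3 := h.dd.2.2.1
  have hlt := h.lt
  have hs := hf.supp a x hpos.ne'
  by_contra hd
  obtain ⟨z, hz, hne, hxz, haz⟩ := hf.not_DD hs.1 hx hs.2.2 hd
  have h4 := hf.tr x a z hx hz
  rcases lt_trichotomy z b with hzb | rfl | hzb
  · have h5 := h.mid z hzb haz
    have h6 := hf.bd z x
    omega
  · omega
  · have h5 := h.dd.2.2.2 z hzb
    have h6 := hf.pl x b z (by omega) hzb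
    omega

theorem Asc.above (hf : Good n s f) {a b : ℕ} (h : Asc n s f a b) {y : ℕ} (hay : a < y)
    (hyb : y < b) : f y a = s y ∨ f b a < f b y := by
  have h1 := h.dd.1
  have h2 := h.dd.2.1
  have h3 := h.dd.2.2.1
  have hlt := h.lt
  by_contra hc
  push Not at hc
  have hd : ¬ DD n f a y := fun hd => hc.1 (h.mid y hyb hd)
  obtain ⟨z, hz, hne, haz, hyz⟩ := hf.not_DD h1 hay (by omega) hd
  have h4 := hf.pl a y z hay hz
  have h7 := hf.pl a y b hay hyb
  rcases lt_trichotomy z b with hzb | rfl | hzb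
  · have h5 := h.mid z hzb haz
    have h6 := hf.bd z y
    have := hc.1
    omega
  · have := hc.1
    omega
  · have h5 := h.dd.2.2.2 z hzb
    have h6 := hf.pl y b z (by omega) hzb
    have := hc.1
    omega

theorem rotf_good (hf : Good n s f) {a b : ℕ} (h : Asc n s f a b) : Good n s (rotf n f a b) where
  bd y x := by
    rw [rotf]
    split_ifs with hc
    · obtain ⟨rfl, hm⟩ := hc
      rw [MM.eq hm h.dd.2.1]
      exact h.lt
    · exact hf.bd y x
  supp y x := by
    rw [rotf]
    split_ifs with hc
    · obtain ⟨rfl, hm⟩ := hc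
      have := hm.dd h.dd
      exact fun _ => ⟨this.1, this.2.1, this.2.2.1⟩
    · exact hf.supp y x
  tr x y z hxy hyz := by
    have hab := h.dd.2.1
    have hT := hf.tr x y z hxy hyz
    have hlx := le_rotf (n := n) (f := f) a b z x
    by_cases hzy : z = b ∧ MM n f a y
    · obtain ⟨rfl, hm⟩ := hzy
      rw [rotf_pos hm, rotf_ne (y := y) (by omega)]
      by_cases hyx : f y x = 0
      · exact Or.inl hyx
      right
      have hy := MM.eq hm hab
      rcases hT with hT | hT
      · exact absurd hT hyx
      by_cases hmx : MM n f a x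
      · rw [rotf_pos hmx]; omega
      · rw [rotf_neg hmx]
        by_contra hc
        apply hmx
        have hax : 0 < f a x := by
          rcases hm with rfl | hm
          · omega
          · have := hf.tr x y a hxy hm.1.2.1
            have := hm.2
            omega
        have hle := hm.le
        exact Or.inr ⟨h.inside hf (by omega) hax (by omega), hax⟩
    · have e1 : rotf n f a b z y = f z y := if_neg hzy
      rw [e1]
      by_cases hyx : y = b ∧ MM n f a x
      · obtain ⟨rfl, hm⟩ := hyx
        have := (hm.dd h.dd).2.2.2 z hyz
        right; omega
      · have e2 : rotf n f a b y x = f y x := if_neg hyx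
        rw [e2]
        omega
  pl x y z hxy hyz := by
    have hab := h.dd.2.1
    have hT := hf.pl x y z hxy hyz
    have hly := le_rotf (n := n) (f := f) a b z y
    by_cases hzx : z = b ∧ MM n f a x
    · obtain ⟨rfl, hm⟩ := hzx
      rw [rotf_pos hm, rotf_ne (y := y) (by omega)]
      have hx := MM.eq hm hab
      rcases lt_trichotomy y a with hya | rfl | hya
      · rcases hm with rfl | hm
        · omega
        · rcases hf.pl x y a hxy hya with h1 | h1
          · exact Or.inl h1
          · right
            have h2 := hf.tr y a z hya hab
            have h3 := hm.2
            by_cases hmy : MM n f a y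
            · rw [rotf_pos hmy]; omega
            · rw [rotf_neg hmy]
              by_contra hc
              exact hmy (Or.inr ⟨h.inside hf hya (by omega) (by omega), by omega⟩)
      · right
        rw [rotf_pos (Or.inl rfl), hx]
      · have := MM.eq hm hya
        rcases h.above hf hya hyz with h1 | h1
        · left; omega
        · right; omega
    · have e1 : rotf n f a b z x = f z x := if_neg hzx
      rw [e1]
      rcases hT with hT | hT
      · left
        by_cases hyx : y = b ∧ MM n f a x
        · obtain ⟨rfl, hm⟩ := hyx
          have := MM.eq hm hab
          have := h.lt
          omega
        · have e2 : rotf n f a b y x = f y x := if_neg hyx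
          rw [e2, hT]
      · right; omega

/-- Any transitive set containing `f + (b,a)` contains the rotation. -/
theorem rotf_le {a b : ℕ} (h : Asc n s f a b) {g : ℕ → ℕ → ℕ} (hg : IsTransitiveInv g)
    (hfg : ∀ y x, f y x ≤ g y x) (hba : f b a < g b a) (y x : ℕ) : rotf n f a b y x ≤ g y x := by
  rw [rotf]
  split_ifs with hc
  · obtain ⟨rfl, hm⟩ := hc
    have := MM.eq hm h.dd.2.1
    rcases hm with rfl | hm
    · omega
    · have h1 := hg x a y hm.1.2.1 h.dd.2.1
      have h2 := hfg a x
      have h3 := hm.2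
      omega
  · exact hfg y x

/-- Nothing lies strictly between. -/
theorem rotf_cover {a b : ℕ} (h : Asc n s f a b) {g : ℕ → ℕ → ℕ} (hg : Good n s g)
    (hfg : ∀ y x, f y x ≤ g y x) (hgr : ∀ y x, g y x ≤ rotf n f a b y x)
    (hne : ¬ ∀ y x, g y x ≤ f y x) : f b a < g b a := by
  push Not at hne
  obtain ⟨y, x, hyx⟩ := hne
  have h1 := hgr y x
  by_cases hc : y = b ∧ MM n f a x
  · obtain ⟨rfl, hm⟩ := hc
    have he := MM.eq hm h.dd.2.1
    rcases hm with rfl | hm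
    · exact hyx
    · have h2 := hg.pl x a y hm.1.2.1 h.dd.2.1
      have h3 := hgr a x
      rw [rotf_ne h.dd.2.1.ne] at h3
      have h4 := hm.2
      have h6 := hg.bd a x
      have h7 := hfg a x
      have h5 := h.leaf (by omega) x hm.1
      omega
  · have e2 : rotf n f a b y x = f y x := if_neg hc
    omega

theorem rotf_strict (a b : ℕ) : f b a < rotf n f a b b a := by
  rw [rotf_pos (Or.inl rfl)]; omega

theorem rotf_inj {a b a' b' : ℕ} (h : rotf n f a b = rotf n f a' b') : a = a' ∧ b = b' := by
  have key : ∀ {a b a' b'}, rotf n f a b = rotf n f a' b' → b = b' ∧ a ≤ a' := by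
    intro a b a' b' h
    have h1 := rotf_strict (n := n) (f := f) a b
    rw [h, rotf] at h1
    split_ifs at h1 with hc
    · exact ⟨hc.1, hc.2.le⟩
    · omega
  have h1 := key h
  have h2 := key h.symm
  omega

theorem asc_disjoint {a a' b x : ℕ} (h : Asc n s f a b) (h' : Asc n s f a' b)
    (hx : MM n f a x) (hx' : MM n f a' x) : a = a' := by
  have key : ∀ {a a'}, Asc n s f a b → Asc n s f a' b → MM n f a x → MM n f a' x → ¬ a < a' := by
    intro a a' h h' hx hx' hlt
    have hle := hx.le
    rcases hx' with rfl | hx'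
    · omega
    have hd : DD n f a a' := by
      rcases hx with rfl | hx
      · exact hx'.1
      · exact hx.1.mid hx'.1 hlt
    have h1 := h.mid a' h'.dd.2.1 hd
    have h2 := MM.eq hx hlt
    exact h'.leaf (by omega) x hx'.1 (by omega)
  rcases lt_trichotomy a a' with h1 | h1 | h1
  · exact (key h h' hx hx' h1).elim
  · exact h1
  · exact (key h' h hx' hx h1).elim

/-- If `f < g` there is an ascent of `f` along which `g` is strictly bigger. -/
theorem exists_asc {g : ℕ → ℕ → ℕ} (hf : Good n s f) (hg : Good n s g)
    (hfg : ∀ y x, f y x ≤ g y x) (hne : ¬ ∀ y x, g y x ≤ f y x) :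
    ∃ a b, Asc n s f a b ∧ f b a < g b a := by
  push Not at hne
  obtain ⟨c, a₀, hca⟩ := hne
  have hr := hg.supp c a₀ (by omega)
  have h0 : ∃ d a b, DD n f a b ∧ f b a < g b a ∧ b - a = d := by
    by_cases hd : DD n f a₀ c
    · exact ⟨_, a₀, c, hd, hca, rfl⟩
    · obtain ⟨z, hz, hne, h1, h2⟩ := hf.not_DD hr.1 hr.2.1 hr.2.2 hd
      refine ⟨_, a₀, z, h1, ?_, rfl⟩
      have h3 := hf.pl a₀ c z hr.2.1 hz
      have h4 := hg.tr a₀ c z hr.2.1 hz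
      have h5 := hfg z c
      have h6 := hg.bd c a₀
      omega
  obtain ⟨a, b, hd, hlt, hba⟩ := Nat.find_spec h0
  have hmin : ∀ a' b', DD n f a' b' → f b' a' < g b' a' → b - a ≤ b' - a' := by
    intro a' b' h1 h2
    rw [hba]
    exact Nat.find_min' h0 ⟨a', b', h1, h2, rfl⟩
  have hmid : ∀ e, e < b → DD n f a e → f e a = s e := by
    intro e heb hae
    have hae' := hae.2.1
    by_contra hse
    have h1 := hmin a e hae
    have h2 := hmin e b (hae.mid hd heb)
    have h3 := hfg e a
    have h4 := hg.pl a e b hae' heb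
    have h5 := hae.2.2.2 b heb
    omega
  have h1 : ∃ a, DD n f a b ∧ f b a < g b a ∧ ∀ e, e < b → DD n f a e → f e a = s e :=
    ⟨a, hd, hlt, hmid⟩
  obtain ⟨h2, h3, h4⟩ := Nat.find_spec h1
  have hmin' := fun m => Nat.find_min (H := h1) (m := m)
  set a := Nat.find h1
  refine ⟨a, b, ⟨h2, ?_, h4, ?_⟩, h3⟩
  · have := hg.bd b a
    omega
  · intro hs x₀ hx₀ hxs₀
    let P : ℕ → Prop := fun x => DD n f x a ∧ f a x = s a
    have hle : ∀ e, DD n f e a → e ≤ n := fun e he => by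
      have := he.2.1
      have := he.2.2.1
      omega
    obtain ⟨hx, hxs⟩ : P (Nat.findGreatest P n) :=
      Nat.findGreatest_spec (hle _ hx₀) (show P x₀ from ⟨hx₀, hxs₀⟩)
    have hmx : ∀ e, P e → e ≤ Nat.findGreatest P n := fun e he =>
      Nat.le_findGreatest (hle _ he.1) he
    set x := Nat.findGreatest P n
    apply hmin' x hx.2.1
    refine ⟨hx.trans h2, ?_, ?_⟩
    · have h5 := hx.2.2.2 b h2.2.1
      have h6 := hg.tr x a b hx.2.1 h2.2.1
      have h7 := hfg a x
      omega
    · intro e heb hxe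
      rcases lt_trichotomy e a with h | rfl | h
      · have h8 := hmx e ⟨hxe.mid hx h, by rw [← hxe.2.2.2 a h, hxs]⟩
        have := hxe.2.1
        omega
      · exact hxs
      · rw [hx.2.2.2 e h]
        exact h4 e heb (hx.mid hxe h)

end SDecTree
namespace SDecTree
variable {n : ℕ} {s : ℕ → ℕ} {f : ℕ → ℕ → ℕ}

theorem tcInv_le {I J : ℕ → ℕ → ℕ} (hJ : IsTransitiveInv J) (h : ∀ y x, I y x ≤ J y x) (y x : ℕ) :
    tcInv I y x ≤ J y x := Nat.sInf_le ⟨J, hJ, h, rfl⟩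

theorem le_tcInv {I J : ℕ → ℕ → ℕ} (hJ : IsTransitiveInv J) (h : ∀ y x, I y x ≤ J y x)
    {y x m : ℕ} (hm : ∀ K, IsTransitiveInv K → (∀ y x, I y x ≤ K y x) → m ≤ K y x) :
    m ≤ tcInv I y x := by
  have : (tcInv I y x) ∈ {m | ∃ J : ℕ → ℕ → ℕ, IsTransitiveInv J ∧
      (∀ y' x', I y' x' ≤ J y' x') ∧ J y x = m} := Nat.sInf_mem ⟨_, J, hJ, h, rfl⟩
  obtain ⟨K, h1, h2, h3⟩ := this
  rw [← h3]
  exact hm K h1 h2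

theorem tcInv_addInv (hf : Good n s f) {a b : ℕ} (h : Asc n s f a b) :
    tcInv (addInv s f b a) = rotf n f a b := by
  have h0 : ∀ y x, addInv s f b a y x ≤ rotf n f a b y x := by
    intro y x
    rw [addInv]
    split_ifs with hc
    · obtain ⟨rfl, rfl⟩ := hc
      rw [rotf_pos (Or.inl rfl)]
      exact min_le_left _ _
    · exact le_rotf _ _ _ _
  funext y x
  apply le_antisymm
  · exact tcInv_le (rotf_good hf h).tr h0 y x
  · refine le_tcInv (rotf_good hf h).tr h0 fun K hK hle => rotf_le h hK (fun y x => ?_) ?_ y x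
    · refine le_trans ?_ (hle y x)
      rw [addInv]
      split_ifs
      · have := hf.bd y x
        omega
      · exact le_rfl
    · have h1 := hle b a
      have h2 := h.lt
      rw [addInv, if_pos ⟨rfl, rfl⟩] at h1
      omega

/-- One step of a positive path. -/
def Stp (I : ℕ → ℕ → ℕ) (u v : ℕ) : Prop := v < u ∧ I u v ≠ 0

/-- Generic closure. -/
noncomputable def clos (s : ℕ → ℕ) (I : ℕ → ℕ → ℕ) : ℕ → ℕ → ℕ := fun c a =>
  Nat.findGreatest (fun i => ∃ b, b < c ∧ Relation.ReflTransGen (Stp I) b a ∧ i = I c b) (s c)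

theorem clos_spec {I : ℕ → ℕ → ℕ} {c a : ℕ} (h : clos s I c a ≠ 0) :
    ∃ b, b < c ∧ Relation.ReflTransGen (Stp I) b a ∧ clos s I c a = I c b :=
  Nat.findGreatest_of_ne_zero (P := fun i => ∃ b, b < c ∧ Relation.ReflTransGen (Stp I) b a ∧
    i = I c b) (n := s c) rfl h

theorem le_clos {I : ℕ → ℕ → ℕ} (hI : ∀ y x, I y x ≤ s y) {c b a : ℕ} (hbc : b < c)
    (h : Relation.ReflTransGen (Stp I) b a) : I c b ≤ clos s I c a :=
  Nat.le_findGreatest (hI c b) ⟨b, hbc, h, rfl⟩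

theorem stp_le {I : ℕ → ℕ → ℕ} {b a : ℕ} (h : Relation.ReflTransGen (Stp I) b a) : a ≤ b := by
  induction h with
  | refl => exact le_rfl
  | tail _ h ih => exact h.1.le.trans ih

theorem clos_pl {I : ℕ → ℕ → ℕ} (hI : ∀ y x, I y x ≤ s y)
    (hpl : ∀ a b c, a < b → b < c → I b a = s b ∨ I c a ≤ I c b) {b d a : ℕ}
    (h : Relation.ReflTransGen (Stp I) d a) (hab : a < b) (hbd : b < d) :
    clos s I b a = s b ∨ Relation.ReflTransGen (Stp I) d b := by
  induction h using Relation.ReflTransGen.head_induction_on with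
  | refl => omega
  | head hde hea ih =>
    rename_i d e
    rcases lt_trichotomy b e with h | rfl | h
    · rcases ih h with h1 | h1
      · exact Or.inl h1
      · exact Or.inr (Relation.ReflTransGen.head hde h1)
    · exact Or.inr (Relation.ReflTransGen.single hde)
    · rcases hpl e b d h hbd with h1 | h1
      · left
        have h2 := le_clos hI h hea
        have h3 : clos s I b a ≤ s b := Nat.findGreatest_le _
        omega
      · right
        have := hde.2
        exact Relation.ReflTransGen.single ⟨hbd, by omega⟩

theorem clos_good {I : ℕ → ℕ → ℕ} (hI : ∀ y x, I y x ≤ s y)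
    (hsupp : ∀ y x, I y x ≠ 0 → 1 ≤ x ∧ x < y ∧ y ≤ n)
    (hpl : ∀ a b c, a < b → b < c → I b a = s b ∨ I c a ≤ I c b) : Good n s (clos s I) where
  bd y x := Nat.findGreatest_le _
  supp y x h := by
    obtain ⟨b, hb, hr, he⟩ := clos_spec h
    have h1 := hsupp y b (by omega)
    have h2 := stp_le hr
    refine ⟨?_, by omega, h1.2.2⟩
    rcases Relation.ReflTransGen.cases_tail hr with h3 | ⟨c, _, h3⟩
    · omega
    · exact (hsupp _ _ h3.2).1
  tr a b c hab hbc := by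
    by_cases h0 : clos s I b a = 0
    · exact Or.inl h0
    right
    by_cases h1 : clos s I c b = 0
    · omega
    obtain ⟨d, hd, hr, he⟩ := clos_spec h0
    obtain ⟨d', hd', hr', he'⟩ := clos_spec h1
    rw [he']
    exact le_clos hI hd' (hr'.trans (hr.head ⟨hd, by omega⟩))
  pl a b c hab hbc := by
    by_cases h0 : clos s I c a = 0
    · right; omega
    obtain ⟨d, hd, hr, he⟩ := clos_spec h0
    rcases lt_trichotomy b d with h | rfl | h
    · rcases clos_pl hI hpl hr hab h with h1 | h1
      · exact Or.inl h1
      · right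
        rw [he]
        exact le_clos hI hd h1
    · right
      rw [he]
      exact le_clos hI hd .refl
    · rcases hpl d b c h hbc with h1 | h1
      · left
        have h2 := le_clos hI h hr
        have h3 : clos s I b a ≤ s b := Nat.findGreatest_le _
        omega
      · right
        have := le_clos hI hbc (.refl : Relation.ReflTransGen (Stp I) b b)
        omega

theorem le_clos_self {I : ℕ → ℕ → ℕ} (hI : ∀ y x, I y x ≤ s y)
    (hsupp : ∀ y x, I y x ≠ 0 → 1 ≤ x ∧ x < y ∧ y ≤ n) (y x : ℕ) : I y x ≤ clos s I y x := by
  by_cases h : I y x = 0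
  · omega
  · exact le_clos hI (hsupp _ _ h).2.1 .refl

theorem clos_le {I K : ℕ → ℕ → ℕ} (hK : IsTransitiveInv K) (h : ∀ y x, I y x ≤ K y x) (y x : ℕ) :
    clos s I y x ≤ K y x := by
  by_cases h0 : clos s I y x = 0
  · omega
  obtain ⟨d, hd, hr, he⟩ := clos_spec h0
  rw [he]
  clear he h0
  induction hr with
  | refl => exact h y d
  | tail hr hs ih =>
    rename_i b c
    have h1 := stp_le hr
    have h2 := hK c b y hs.1 (by omega)
    have h3 := h b c
    have h4 := hs.2
    omega

/-- The ascents considered. -/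
def Sel (T Z : SDecTree n s) (p : ℕ × ℕ) : Prop :=
  Asc n s T.card p.1 p.2 ∧ T.card p.2 p.1 < Z.card p.2 p.1

theorem mem_ARot (T : SDecTree n s) {a b : ℕ} (h : Asc n s T.card a b) {y x : ℕ} :
    (y, x) ∈ ARot T a b ↔ y = b ∧ MM n T.card a x := by
  simp only [ARot, Set.mem_setOf_eq, tcInv_addInv T.card_good h]
  rw [rotf]
  split_ifs with hc
  · simp [hc]
  · simp [hc]

theorem ascSum_cases (T Z : SDecTree n s) (y x : ℕ) :
    (ascSum n s T Z y x = T.card y x ∧ ∀ p, Sel T Z p → rotf n T.card p.1 p.2 y x = T.card y x) ∨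
    (ascSum n s T Z y x = T.card y x + 1 ∧
      ∃ p, Sel T Z p ∧ rotf n T.card p.1 p.2 y x = T.card y x + 1) := by
  have hset : {p : ℕ × ℕ | T.TreeAscent p.1 p.2 ∧ T.card p.2 p.1 < Z.card p.2 p.1 ∧
        (y, x) ∈ SDecTree.ARot T p.1 p.2} = {p | Sel T Z p ∧ y = p.2 ∧ MM n T.card p.1 x} := by
    ext p
    simp only [Set.mem_setOf_eq, Sel, treeAscent_iff]
    constructor
    · rintro ⟨h1, h2, h3⟩
      exact ⟨⟨h1, h2⟩, (mem_ARot T h1).1 h3⟩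
    · rintro ⟨⟨h1, h2⟩, h3⟩
      exact ⟨h1, h2, (mem_ARot T h1).2 h3⟩
  rw [ascSum, hset]
  by_cases hex : ∃ p, Sel T Z p ∧ y = p.2 ∧ MM n T.card p.1 x
  · right
    obtain ⟨p, hp, rfl, hm⟩ := hex
    have h1 : {q | Sel T Z q ∧ p.2 = q.2 ∧ MM n T.card q.1 x} = {p} := by
      ext q
      simp only [Set.mem_setOf_eq, Set.mem_singleton_iff]
      constructor
      · rintro ⟨hq, he, hm'⟩
        have hq1 := hq.1
        rw [← he] at hq1
        exact Prod.ext (asc_disjoint hq1 hp.1 hm' hm) he.symm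
      · rintro rfl
        exact ⟨hp, rfl, hm⟩
    rw [h1, Set.ncard_singleton]
    have h2 := (rotf_good T.card_good hp.1).bd p.2 x
    rw [rotf_pos hm] at h2
    exact ⟨by omega, p, hp, rotf_pos hm⟩
  · left
    have h1 : {q | Sel T Z q ∧ y = q.2 ∧ MM n T.card q.1 x} = ∅ := by
      ext q
      simp only [Set.mem_setOf_eq, Set.mem_empty_iff_false, iff_false]
      exact fun h => hex ⟨q, h⟩
    rw [h1, Set.ncard_empty]
    have := T.card_le y x
    refine ⟨by omega, fun p hp => if_neg fun hc => hex ⟨p, hp, hc⟩⟩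

theorem rotf_le_ascSum (T Z : SDecTree n s) {p : ℕ × ℕ} (hp : Sel T Z p) (y x : ℕ) :
    rotf n T.card p.1 p.2 y x ≤ ascSum n s T Z y x := by
  rcases ascSum_cases T Z y x with ⟨h1, h2⟩ | ⟨h1, -⟩
  · rw [h1, h2 p hp]
  · rw [h1, rotf]
    split_ifs <;> omega

theorem card_le_ascSum (T Z : SDecTree n s) (y x : ℕ) : T.card y x ≤ ascSum n s T Z y x := by
  rcases ascSum_cases T Z y x with ⟨h1, h2⟩ | ⟨h1, -⟩ <;> omega

theorem ascSum_le {T Z : SDecTree n s} {g : ℕ → ℕ → ℕ} (h0 : ∀ y x, T.card y x ≤ g y x)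
    (h : ∀ p, Sel T Z p → ∀ y x, rotf n T.card p.1 p.2 y x ≤ g y x) (y x : ℕ) :
    ascSum n s T Z y x ≤ g y x := by
  rcases ascSum_cases T Z y x with ⟨h1, h2⟩ | ⟨h1, p, hp, h2⟩
  · rw [h1]; exact h0 y x
  · rw [h1, ← h2]; exact h p hp y x

theorem ascSum_bd (T Z : SDecTree n s) (y x : ℕ) : ascSum n s T Z y x ≤ s y := min_le_right _ _

theorem ascSum_supp (T Z : SDecTree n s) (y x : ℕ) (h : ascSum n s T Z y x ≠ 0) :
    1 ≤ x ∧ x < y ∧ y ≤ n := by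
  rcases ascSum_cases T Z y x with ⟨h1, h2⟩ | ⟨h1, p, hp, h2⟩
  · exact T.card_good.supp y x (by omega)
  · exact (rotf_good T.card_good hp.1).supp y x (by omega)

theorem ascSum_pl (T Z : SDecTree n s) (a b c : ℕ) (hab : a < b) (hbc : b < c) :
    ascSum n s T Z b a = s b ∨ ascSum n s T Z c a ≤ ascSum n s T Z c b := by
  have hb := ascSum_bd T Z b a
  rcases ascSum_cases T Z c a with ⟨h1, h2⟩ | ⟨h1, p, hp, h2⟩
  · have h3 := T.card_good.pl a b c hab hbc
    have h4 := card_le_ascSum T Z b a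
    have h5 := card_le_ascSum T Z c b
    omega
  · have h3 := (rotf_good T.card_good hp.1).pl a b c hab hbc
    have h4 := rotf_le_ascSum T Z hp b a
    have h5 := rotf_le_ascSum T Z hp c b
    omega

theorem wcov_iff (T U : SDecTree n s) :
    wcov T U ↔ ∃ p : ℕ × ℕ, Asc n s T.card p.1 p.2 ∧ U.card = rotf n T.card p.1 p.2 := by
  constructor
  · rintro ⟨⟨h1, h2⟩, h3⟩
    obtain ⟨a, b, hasc, hlt⟩ := exists_asc T.card_good U.card_good h1 h2
    refine ⟨(a, b), hasc, ?_⟩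
    set R := ofGood (rotf_good T.card_good hasc) with hR
    have hRc : R.card = rotf n T.card a b := ofGood_card _
    have hRU : wle R U := fun y x => by
      rw [hRc]; exact rotf_le hasc U.card_good.tr h1 hlt y x
    have hTR : wlt T R := by
      refine ⟨fun y x => by rw [hRc]; exact le_rotf _ _ _ _, fun h => ?_⟩
      have h4 := h b a
      have h5 := rotf_strict (n := n) (f := T.card) a b
      rw [hRc] at h4
      omega
    have hUR : wle U R := by
      by_contra hc
      exact h3 R hTR ⟨hRU, hc⟩
    rw [← hRc]
    funext y x
    exact le_antisymm (hUR y x) (hRU y x)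
  · rintro ⟨⟨a, b⟩, hasc, hU⟩
    simp only at hasc hU
    refine ⟨⟨fun y x => by rw [hU]; exact le_rotf _ _ _ _, fun h => ?_⟩, ?_⟩
    · have h4 := h b a
      have h5 := rotf_strict (n := n) (f := T.card) a b
      rw [hU] at h4
      omega
    · rintro V ⟨h1, h2⟩ ⟨h3, h4⟩
      apply h4
      have h5 := rotf_cover hasc V.card_good h1 (fun y x => by rw [← hU]; exact h3 y x) h2
      intro y x
      rw [hU]
      exact rotf_le hasc V.card_good.tr h1 h5 y x

theorem rotf_le_iff {T Z : SDecTree n s} (hle : wle T Z) {a b : ℕ} (h : Asc n s T.card a b) :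
    (∀ y x, rotf n T.card a b y x ≤ Z.card y x) ↔ T.card b a < Z.card b a := by
  constructor
  · intro h1
    exact lt_of_lt_of_le (rotf_strict _ _) (h1 b a)
  · intro h1
    exact rotf_le h Z.card_good.tr hle h1

theorem atoms_card {T Z : SDecTree n s} (hle : wle T Z) :
    {U : SDecTree n s | SDecTree.wcov T U ∧ SDecTree.wle U Z}.ncard =
      {p : ℕ × ℕ | T.TreeAscent p.1 p.2 ∧ T.card p.2 p.1 < Z.card p.2 p.1}.ncard := by
  symm
  refine Set.ncard_congr
    (fun p hp => ofGood (rotf_good T.card_good ((treeAscent_iff T).1 hp.1))) ?_ ?_ ?_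
  · rintro p ⟨h1, h2⟩
    have h3 := (treeAscent_iff T).1 h1
    refine ⟨(wcov_iff _ _).2 ⟨p, h3, ofGood_card _⟩, fun y x => ?_⟩
    rw [ofGood_card]
    exact (rotf_le_iff hle h3).2 h2 y x
  · intro p q hp hq h
    have h1 := congrArg card h
    simp only [ofGood_card] at h1
    have h2 := rotf_inj h1
    exact Prod.ext h2.1 h2.2
  · rintro U ⟨h1, h2⟩
    obtain ⟨p, hp, hU⟩ := (wcov_iff _ _).1 h1
    refine ⟨p, ⟨(treeAscent_iff T).2 hp, (rotf_le_iff hle hp).1 fun y x => ?_⟩, ?_⟩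
    · rw [← hU]; exact h2 y x
    · apply card_injective
      rw [ofGood_card, hU]

theorem upper_iff {T Z : SDecTree n s} (hlt : wlt T Z) (V : SDecTree n s) :
    (∀ U : SDecTree n s, SDecTree.wcov T U → SDecTree.wle U Z → SDecTree.wle U V) ↔
      ∀ y x, ascSum n s T Z y x ≤ V.card y x := by
  constructor
  · intro h
    have h1 : ∀ p, Sel T Z p → ∀ y x, rotf n T.card p.1 p.2 y x ≤ V.card y x := by
      intro p hp y x
      have hc := ofGood_card (rotf_good T.card_good hp.1)
      have := h (ofGood (rotf_good T.card_good hp.1)) ((wcov_iff _ _).2 ⟨p, hp.1, hc⟩)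
        (fun y x => by rw [hc]; exact (rotf_le_iff hlt.1 hp.1).2 hp.2 y x) y x
      rwa [hc] at this
    obtain ⟨a, b, h2, h3⟩ := exists_asc T.card_good Z.card_good hlt.1 hlt.2
    exact ascSum_le (fun y x => (le_rotf a b y x).trans (h1 (a, b) ⟨h2, h3⟩ y x)) h1
  · intro h U hU hUZ y x
    obtain ⟨p, hp, hc⟩ := (wcov_iff _ _).1 hU
    have hs : Sel T Z p := ⟨hp, (rotf_le_iff hlt.1 hp).1 fun y x => by rw [← hc]; exact hUZ y x⟩
    rw [hc]
    exact (rotf_le_ascSum T Z hs y x).trans (h y x)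

end SDecTree

/-- the interval `[T,Z]` has exactly as many atoms as there are tree
ascents `(a,b)` of `T` with `(b,a) ∈ inv Z − inv T`, and `Z` is the join of the atoms of
`[T,Z]` iff `inv Z = (inv T + A_T(a₁,b₁) + ⋯ + A_T(a_l,b_l))^tc`. -/
theorem join_of_atoms_charact (n : ℕ) (s : ℕ → ℕ) (T Z : SDecTree n s)
    (hlt : SDecTree.wlt T Z) :
    {U : SDecTree n s | SDecTree.wcov T U ∧ SDecTree.wle U Z}.ncard =
      {p : ℕ × ℕ | T.TreeAscent p.1 p.2 ∧ T.card p.2 p.1 < Z.card p.2 p.1}.ncard ∧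
    ((∀ V : SDecTree n s,
        (∀ U : SDecTree n s, SDecTree.wcov T U → SDecTree.wle U Z → SDecTree.wle U V) →
        SDecTree.wle Z V) ↔
      (∀ y x, 1 ≤ x → x < y → y ≤ n → Z.card y x = tcInv (ascSum n s T Z) y x)) := by
  refine ⟨SDecTree.atoms_card hlt.1, ?_⟩
  simp only [SDecTree.upper_iff hlt]
  have hZ : ∀ y x, ascSum n s T Z y x ≤ Z.card y x :=
    SDecTree.ascSum_le hlt.1 fun p hp => (SDecTree.rotf_le_iff hlt.1 hp.1).2 hp.2
  have hbd := SDecTree.ascSum_bd T Z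
  have hsupp := SDecTree.ascSum_supp T Z
  constructor
  · intro h y x _ _ _
    apply le_antisymm
    · have hg := SDecTree.clos_good hbd hsupp (SDecTree.ascSum_pl T Z)
      have h1 := h (SDecTree.ofGood hg) (fun y x => by
        rw [SDecTree.ofGood_card]
        exact SDecTree.le_clos_self hbd hsupp y x) y x
      rw [SDecTree.ofGood_card] at h1
      exact h1.trans (SDecTree.le_tcInv Z.card_good.tr hZ fun K hK hle =>
        SDecTree.clos_le hK hle y x)
    · exact SDecTree.tcInv_le Z.card_good.tr hZ y x
  · intro h V hV y x
    by_cases hr : 1 ≤ x ∧ x < y ∧ y ≤ n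
    · rw [h y x hr.1 hr.2.1 hr.2.2]
      exact SDecTree.tcInv_le V.card_good.tr hV y x
    · rw [SDecTree.card_out hr]
      exact Nat.zero_le _
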